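/- Let α > 1, f ∈ SR_α, b < α, and let k₀, k₁ ∈ SR_b be such that c := lim_{Λ→∞}(k₁(Λ) − k₀(Λ)) exists in ℝ. For i ∈ {0,1} let g_i be the solution, defined for all sufficiently large Λ, of g_i(Λ)·f′(g_i(Λ)) − f(g_i(Λ)) + k_i(g_i(Λ)) = ln Λ. Then for each i ∈ {0,1}: lim_{Λ→∞} g_i(Λ)·(f′(g₀(Λ)) − f′(g₁(Λ))) = c. -/

import Mathlib

open MeasureTheory Filter Real Set
open scoped Topology BigOperators ENNReal

noncomputable section

/-- `f` is smoothly regularly varying of index `α`: beyond some `z₀ ≥ 1` it is positive and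
infinitely differentiable, and `h u = log (f (exp u))` satisfies `h' → α` and
`h^(m) → 0` for every `m ≥ 2`. -/
def SmoothRegVary (α : ℝ) (f : ℝ → ℝ) : Prop :=
  ∃ z₀ : ℝ, 1 ≤ z₀ ∧ (∀ x, z₀ < x → 0 < f x) ∧
    ContDiffOn ℝ (⊤ : ℕ∞) f (Set.Ioi z₀) ∧
    Filter.Tendsto (deriv (fun u => Real.log (f (Real.exp u)))) Filter.atTop (nhds α) ∧
    ∀ m : ℕ, 2 ≤ m →
      Filter.Tendsto (iteratedDeriv m (fun u => Real.log (f (Real.exp u))))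
        Filter.atTop (nhds 0)

/-- A function whose derivative has a positive limit at infinity tends to infinity. -/
lemma tendsto_atTop_of_deriv_tendsto_pos {h : ℝ → ℝ} {l : ℝ} (hl : 0 < l)
    (hd : ∀ᶠ u in atTop, DifferentiableAt ℝ h u) (hlim : Tendsto (deriv h) atTop (𝓝 l)) :
    Tendsto h atTop atTop := by
  obtain ⟨a, ha⟩ := eventually_atTop.1 (hd.and (hlim.eventually (lt_mem_nhds (half_lt_self hl))))
  have hbound : ∀ u, a ≤ u → l / 2 * (u - a) + h a ≤ h u := fun u hu => by
    have := (convex_Ici a).mul_sub_le_image_sub_of_le_deriv (f := h) (C := l / 2)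
      (fun v hv => (ha v hv).1.continuousAt.continuousWithinAt)
      (fun v hv => (ha v (interior_subset hv)).1.differentiableWithinAt)
      (fun v hv => (ha v (interior_subset hv)).2.le) a self_mem_Ici u hu hu
    linarith
  refine tendsto_atTop_mono' _ (eventually_atTop.2 ⟨a, hbound⟩) ?_
  exact tendsto_atTop_add_const_right _ _
    ((tendsto_atTop_add_const_right _ (-a) tendsto_id).const_mul_atTop (half_pos hl))

/-- Cauchy's mean value theorem along two functions tending to infinity. -/
lemma exists_cauchy_mean_value_tendsto_atTop {G G' H H' x y : ℝ → ℝ}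
    (hG : ∀ᶠ t in atTop, HasDerivAt G (G' t) t) (hH : ∀ᶠ t in atTop, HasDerivAt H (H' t) t)
    (hne : ∀ᶠ t in atTop, G' t ≠ 0)
    (hx : Tendsto x atTop atTop) (hy : Tendsto y atTop atTop) :
    ∃ ξ : ℝ → ℝ, Tendsto ξ atTop atTop ∧ ∀ᶠ s in atTop, ξ s ∈ uIcc (x s) (y s) ∧
      H (x s) - H (y s) = (G (x s) - G (y s)) * (H' (ξ s) / G' (ξ s)) := by
  obtain ⟨a, ha⟩ := eventually_atTop.1 (hG.and (hH.and hne))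
  have key : ∀ p q, a ≤ p → p < q → ∃ t ∈ Icc p q,
      H q - H p = (G q - G p) * (H' t / G' t) := fun p q hp hpq => by
    obtain ⟨t, ht, he⟩ := exists_ratio_hasDerivAt_eq_ratio_slope G G' hpq
      (fun v hv => (ha v (hp.trans hv.1)).1.continuousAt.continuousWithinAt)
      (fun v hv => (ha v (hp.trans hv.1.le)).1) H H'
      (fun v hv => (ha v (hp.trans hv.1)).2.1.continuousAt.continuousWithinAt)
      (fun v hv => (ha v (hp.trans hv.1.le)).2.1)
    have := (ha t (hp.trans ht.1.le)).2.2
    exact ⟨t, Ioo_subset_Icc_self ht, by field_simp; linarith⟩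
  have hex : ∀ s, ∃ t ∈ uIcc (x s) (y s), a ≤ x s → a ≤ y s →
      H (x s) - H (y s) = (G (x s) - G (y s)) * (H' t / G' t) := fun s => by
    by_cases h : a ≤ x s ∧ a ≤ y s
    · rcases lt_trichotomy (x s) (y s) with hlt | heq | hgt
      · obtain ⟨t, ht, he⟩ := key _ _ h.1 hlt
        exact ⟨t, Icc_subset_uIcc ht, fun _ _ => by linarith⟩
      · exact ⟨x s, left_mem_uIcc, fun _ _ => by simp [heq]⟩
      · obtain ⟨t, ht, he⟩ := key _ _ h.2 hgt
        exact ⟨t, Icc_subset_uIcc' ht, fun _ _ => he⟩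
    · exact ⟨x s, left_mem_uIcc, fun h1 h2 => absurd ⟨h1, h2⟩ h⟩
  choose ξ hmem heq using hex
  refine ⟨ξ, tendsto_atTop.2 fun M => ?_, ?_⟩
  · filter_upwards [hx.eventually_ge_atTop M, hy.eventually_ge_atTop M] with s h1 h2
    exact (le_inf h1 h2).trans (hmem s).1
  · filter_upwards [hx.eventually_ge_atTop a, hy.eventually_ge_atTop a] with s h1 h2
    exact ⟨hmem s, heq s h1 h2⟩

namespace SmoothRegVary

variable {α b : ℝ} {f k : ℝ → ℝ}

lemma eventually_pos (hf : SmoothRegVary α f) : ∀ᶠ t in atTop, 0 < f t := by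
  obtain ⟨z, -, hpos, -⟩ := hf
  exact (eventually_gt_atTop z).mono hpos

lemma eventually_hasDerivAt (hf : SmoothRegVary α f) :
    ∀ᶠ t in atTop, HasDerivAt f (deriv f t) t := by
  obtain ⟨z, -, -, hsm, -⟩ := hf
  exact (eventually_gt_atTop z).mono fun t ht =>
    ((hsm.differentiableOn (by simp)).differentiableAt (Ioi_mem_nhds ht)).hasDerivAt

lemma eventually_hasDerivAt_deriv (hf : SmoothRegVary α f) :
    ∀ᶠ t in atTop, HasDerivAt (deriv f) (deriv (deriv f) t) t := by
  obtain ⟨z, -, -, hsm, -⟩ := hf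
  exact (eventually_gt_atTop z).mono fun t ht =>
    ((((contDiffOn_infty_iff_deriv_of_isOpen isOpen_Ioi).1 hsm).2.differentiableOn
      (by simp)).differentiableAt (Ioi_mem_nhds ht)).hasDerivAt

lemma eventually_hasDerivAt_log_comp_exp (hf : SmoothRegVary α f) :
    ∀ᶠ u in atTop, HasDerivAt (fun u => log (f (exp u)))
      (exp u * deriv f (exp u) / f (exp u)) u := by
  filter_upwards [tendsto_exp_atTop.eventually hf.eventually_pos,
    tendsto_exp_atTop.eventually hf.eventually_hasDerivAt] with u hpos hd
  simpa [mul_comm] using (hd.comp u (hasDerivAt_exp u)).log hpos.ne'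

lemma tendsto_deriv_log_comp_exp (hf : SmoothRegVary α f) :
    Tendsto (deriv fun u => log (f (exp u))) atTop (𝓝 α) := by
  obtain ⟨-, -, -, -, h, -⟩ := hf
  exact h

/-- The logarithmic derivative `t f'(t) / f(t)` tends to the index. -/
lemma tendsto_mul_deriv_div (hf : SmoothRegVary α f) :
    Tendsto (fun t => t * deriv f t / f t) atTop (𝓝 α) := by
  refine (hf.tendsto_deriv_log_comp_exp.comp tendsto_log_atTop).congr' ?_
  filter_upwards [tendsto_log_atTop.eventually hf.eventually_hasDerivAt_log_comp_exp,
    eventually_gt_atTop 0] with t ht h0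
  simpa [exp_log h0] using ht.deriv

lemma eventually_eventually_hasDerivAt_log_comp_exp (hf : SmoothRegVary α f) :
    ∀ᶠ u in atTop, ∀ᶠ v in 𝓝 u, HasDerivAt (fun u => log (f (exp u)))
      (exp v * deriv f (exp v) / f (exp v)) v := by
  obtain ⟨a, ha⟩ := eventually_atTop.1 hf.eventually_hasDerivAt_log_comp_exp
  exact (eventually_gt_atTop a).mono fun u hu => (eventually_ge_nhds hu).mono ha

lemma tendsto_sq_mul_deriv_deriv_div (hf : SmoothRegVary α f) :
    Tendsto (fun t => t ^ 2 * deriv (deriv f) t / f t) atTop (𝓝 (α * (α - 1))) := by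
  have hlim : Tendsto (iteratedDeriv 2 fun u => log (f (exp u))) atTop (𝓝 0) := by
    obtain ⟨-, -, -, -, -, h⟩ := hf
    exact h 2 le_rfl
  have hsum := ((hlim.comp tendsto_log_atTop).sub hf.tendsto_mul_deriv_div).add
    (hf.tendsto_mul_deriv_div.pow 2)
  rw [show 0 - α + α ^ 2 = α * (α - 1) by ring] at hsum
  refine hsum.congr' ?_
  filter_upwards [tendsto_log_atTop.eventually
      hf.eventually_eventually_hasDerivAt_log_comp_exp,
    eventually_gt_atTop 0, hf.eventually_pos, hf.eventually_hasDerivAt,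
    hf.eventually_hasDerivAt_deriv] with t ht h0 hpos hd hdd
  have hexp := hasDerivAt_exp (log t)
  have he : exp (log t) = t := exp_log h0
  have hd1 : HasDerivAt (fun u => f (exp u)) (deriv f t * t) (log t) :=
    (hd.comp_of_eq (log t) hexp he.symm).congr_deriv (by rw [he])
  have hd2 : HasDerivAt (fun u => deriv f (exp u)) (deriv (deriv f) t * t) (log t) :=
    (hdd.comp_of_eq (log t) hexp he.symm).congr_deriv (by rw [he])
  have hq := ((hexp.fun_mul hd2).fun_div hd1 (by rw [he]; exact hpos.ne')).deriv
  have heq : (deriv fun u => log (f (exp u))) =ᶠ[𝓝 (log t)]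
      fun u => exp u * deriv f (exp u) / f (exp u) := ht.mono fun _ h => h.deriv
  simp only [Function.comp_apply, iteratedDeriv_succ, iteratedDeriv_zero]
  rw [heq.deriv_eq, hq, he]
  field_simp
  ring

lemma tendsto_atTop (hf : SmoothRegVary α f) (hα : 0 < α) : Tendsto f atTop atTop := by
  have h := tendsto_atTop_of_deriv_tendsto_pos hα
    (hf.eventually_hasDerivAt_log_comp_exp.mono fun _ h => h.differentiableAt)
    hf.tendsto_deriv_log_comp_exp
  refine (tendsto_exp_atTop.comp (h.comp tendsto_log_atTop)).congr' ?_
  filter_upwards [eventually_gt_atTop 0, hf.eventually_pos] with t h0 hpos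
  simp [exp_log h0, exp_log hpos]

/-- A function of smaller index is negligible. -/
lemma tendsto_div_zero (hf : SmoothRegVary α f) (hk : SmoothRegVary b k) (hb : b < α) :
    Tendsto (fun t => k t / f t) atTop (𝓝 0) := by
  have hd := hf.eventually_hasDerivAt_log_comp_exp.and hk.eventually_hasDerivAt_log_comp_exp
  have h := tendsto_atTop_of_deriv_tendsto_pos
    (h := fun u => log (f (exp u)) - log (k (exp u))) (sub_pos.2 hb)
    (hd.mono fun _ h => (h.1.sub h.2).differentiableAt)
    ((hf.tendsto_deriv_log_comp_exp.sub hk.tendsto_deriv_log_comp_exp).congr' <| hd.mono fun u h => by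
      rw [(h.1.fun_sub h.2).deriv, h.1.deriv, h.2.deriv])
  refine (tendsto_exp_neg_atTop_nhds_zero.comp (h.comp tendsto_log_atTop)).congr' ?_
  filter_upwards [eventually_gt_atTop 0, hf.eventually_pos, hk.eventually_pos] with t h0 hpos hkpos
  simp [exp_log h0, exp_log hpos, exp_log hkpos, exp_sub]

lemma tendsto_mul_deriv_div_zero (hf : SmoothRegVary α f) (hk : SmoothRegVary b k)
    (hb : b < α) : Tendsto (fun t => t * deriv k t / f t) atTop (𝓝 0) := by
  have h := hk.tendsto_mul_deriv_div.mul (hf.tendsto_div_zero hk hb)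
  rw [mul_zero] at h
  refine h.congr' ?_
  filter_upwards [hf.eventually_pos, hk.eventually_pos] with t hpos hkpos
  field_simp

end SmoothRegVary

/-- Lemma 2.6(iv): sensitivity of the solution of the functional equation:
if `k₁ - k₀ → c` then `gᵢ(Λ)(f'(g₀(Λ)) - f'(g₁(Λ))) → c` for `i ∈ {0,1}`. -/
theorem stmt7 {α b : ℝ} (hα : 1 < α) (hb : b < α) {f k₀ k₁ : ℝ → ℝ}
    (hf : SmoothRegVary α f) (hk₀ : SmoothRegVary b k₀) (hk₁ : SmoothRegVary b k₁)
    (c : ℝ) (hc : Filter.Tendsto (fun Λ : ℝ => k₁ Λ - k₀ Λ) Filter.atTop (nhds c))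
    (r₀ : ℝ) (hr₀ : 0 < r₀) (g₀ g₁ : ℝ → ℝ)
    (hg₀top : Filter.Tendsto g₀ Filter.atTop Filter.atTop)
    (hg₁top : Filter.Tendsto g₁ Filter.atTop Filter.atTop)
    (hg₀ : ∀ Λ : ℝ, r₀ < Λ →
      g₀ Λ * deriv f (g₀ Λ) - f (g₀ Λ) + k₀ (g₀ Λ) = Real.log Λ)
    (hg₁ : ∀ Λ : ℝ, r₀ < Λ →
      g₁ Λ * deriv f (g₁ Λ) - f (g₁ Λ) + k₁ (g₁ Λ) = Real.log Λ) :
    Filter.Tendsto (fun Λ : ℝ => g₀ Λ * (deriv f (g₀ Λ) - deriv f (g₁ Λ)))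
        Filter.atTop (nhds c) ∧
    Filter.Tendsto (fun Λ : ℝ => g₁ Λ * (deriv f (g₀ Λ) - deriv f (g₁ Λ)))
        Filter.atTop (nhds c) := by
  set G : ℝ → ℝ := fun t => t * deriv f t - f t + k₀ t with hGdef
  set G' : ℝ → ℝ := fun t => t * deriv (deriv f) t + deriv k₀ t with hG'def
  have hβ : 0 < α * (α - 1) := mul_pos (by linarith) (by linarith)
  have hG : ∀ᶠ t in atTop, HasDerivAt G (G' t) t := by
    filter_upwards [hf.eventually_hasDerivAt, hf.eventually_hasDerivAt_deriv,
      hk₀.eventually_hasDerivAt] with t h1 h2 h3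
    refine ((((hasDerivAt_id t).fun_mul h2).fun_sub h1).fun_add h3).congr_deriv ?_
    simp [hG'def]
  have hratio : Tendsto (fun t => t * G' t / f t) atTop (𝓝 (α * (α - 1))) := by
    have h := hf.tendsto_sq_mul_deriv_deriv_div.add (hf.tendsto_mul_deriv_div_zero hk₀ hb)
    rw [add_zero] at h
    exact h.congr fun t => by simp only [hG'def]; ring
  have hmulG' : Tendsto (fun t => t * G' t) atTop atTop := by
    refine (hratio.pos_mul_atTop hβ (hf.tendsto_atTop (by linarith))).congr' ?_
    filter_upwards [hf.eventually_pos] with t hpos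
    field_simp
  have hne : ∀ᶠ t in atTop, G' t ≠ 0 :=
    (hmulG'.eventually_gt_atTop 0).mono fun t ht => right_ne_zero_of_mul ht.ne'
  have hGdiff : Tendsto (fun s => G (g₀ s) - G (g₁ s)) atTop (𝓝 c) := by
    refine (hc.comp hg₁top).congr' ?_
    filter_upwards [eventually_gt_atTop r₀] with s hs
    have h0 := hg₀ s hs
    have h1 := hg₁ s hs
    simp only [Function.comp_apply, hGdef]
    linarith
  have hlog : Tendsto (fun s => log (g₀ s) - log (g₁ s)) atTop (𝓝 0) := by
    obtain ⟨η, hη, hηeq⟩ := exists_cauchy_mean_value_tendsto_atTop (H := log)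
      (H' := fun t => t⁻¹) hG ((eventually_ne_atTop 0).mono fun t ht => hasDerivAt_log ht)
      hne hg₀top hg₁top
    have h := hGdiff.mul (tendsto_inv_atTop_zero.comp (hmulG'.comp hη))
    rw [mul_zero] at h
    refine h.congr' (hηeq.mono fun s hs => ?_)
    simp only [hs.2, Function.comp_apply, mul_inv, div_eq_mul_inv]
  obtain ⟨ξ, hξ, hξeq⟩ := exists_cauchy_mean_value_tendsto_atTop hG
    hf.eventually_hasDerivAt_deriv hne hg₀top hg₁top
  have hquot : Tendsto (fun t => t * (deriv (deriv f) t / G' t)) atTop (𝓝 1) := by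
    have h := hf.tendsto_sq_mul_deriv_deriv_div.div hratio hβ.ne'
    rw [div_self hβ.ne'] at h
    refine h.congr' ?_
    filter_upwards [hf.eventually_pos, hne, eventually_gt_atTop 0] with t hpos hn h0
    simp only [Pi.div_apply]
    field_simp
  have hξlim : Tendsto (fun s => ξ s * (deriv f (g₀ s) - deriv f (g₁ s))) atTop (𝓝 c) := by
    have h := hGdiff.mul (hquot.comp hξ)
    rw [mul_one] at h
    refine h.congr' (hξeq.mono fun s hs => ?_)
    simp only [hs.2, Function.comp_apply]
    ring
  have htransfer : ∀ g : ℝ → ℝ, Tendsto g atTop atTop →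
      (∀ s, g s ∈ uIcc (g₀ s) (g₁ s)) →
      Tendsto (fun s => g s * (deriv f (g₀ s) - deriv f (g₁ s))) atTop (𝓝 c) := by
    intro g hg hmem
    have hdiff : Tendsto (fun s => log (g s) - log (ξ s)) atTop (𝓝 0) := by
      refine squeeze_zero_norm' ?_ (by simpa using hlog.abs)
      filter_upwards [hξeq, hg₀top.eventually_gt_atTop 0, hg₁top.eventually_gt_atTop 0]
        with s hs h0 h1
      have hlogmem : ∀ t ∈ uIcc (g₀ s) (g₁ s),
          log t ∈ uIcc (log (g₀ s)) (log (g₁ s)) := fun t ht =>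
        (strictMonoOn_log.monotoneOn.mono fun v hv =>
          (lt_inf_iff.2 ⟨h0, h1⟩).trans_le hv.1).mapsTo_uIcc ht
      have := abs_sub_le_of_uIcc_subset_uIcc
        (uIcc_subset_uIcc (hlogmem _ hs.1) (hlogmem _ (hmem s)))
      rwa [Real.norm_eq_abs, abs_sub_comm (log (g₀ s))]
    have h := ((continuous_exp.tendsto 0).comp hdiff).mul hξlim
    rw [exp_zero, one_mul] at h
    refine h.congr' ?_
    filter_upwards [hg.eventually_gt_atTop 0, hξ.eventually_gt_atTop 0] with s h1 h2
    simp only [Function.comp_apply, exp_sub, exp_log h1, exp_log h2]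
    field_simp
  exact ⟨htransfer g₀ hg₀top fun _ => left_mem_uIcc, htransfer g₁ hg₁top fun _ => right_mem_uIcc⟩
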